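/- Let α be a real number with −1 < α < 1, and adopt the convention sgn(0) = 1. For every y > 0 the series ∑_{m ∈ ℤ, m ≠ 0} (1/(m + 2iy) − 1/m)·e^{2πimα} converges absolutely, and the limit of its sum as y → +∞ exists and equals −2πi·sgn(α)·(1/2 − |α|). -/

import Mathlib

open Real Filter Complex

/-- The sign function with the convention `sgn 0 = 1`. -/
noncomputable def sgn' (x : ℝ) : ℝ := if x = 0 then 1 else Real.sign x

open MeasureTheory in
lemma aux_int_ne (c K d : ℂ) (hK : K ≠ 0) (hcK : Complex.exp c = K + 1) (hd : d ≠ 0)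
    (hcd : c - d ≠ 0) (hexp : Complex.exp d = 1) :
    ∫ x in (0:ℝ)..1, Complex.exp (-d * x) *
      ((x : ℂ) - 1/2 + 1/c - Complex.exp (c * x) / K) = -1/d - 1/(c-d) := by
  have key : ∀ x : ℝ, HasDerivAt (fun x : ℝ => -((x : ℂ) - 1/2 + 1/c) * Complex.exp (-d * x) / d
      - Complex.exp (-d * x) / d^2 - Complex.exp ((c - d) * x) / ((c-d)*K))
      (Complex.exp (-d * x) * ((x : ℂ) - 1/2 + 1/c - Complex.exp (c * x) / K)) x := by
    intro x
    have h0 : HasDerivAt (fun x : ℂ => -(x - 1/2 + 1/c) * Complex.exp (-d * x) / d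
      - Complex.exp (-d * x) / d^2 - Complex.exp ((c - d) * x) / ((c-d)*K))
      (Complex.exp (-d * x) * ((x : ℂ) - 1/2 + 1/c - Complex.exp (c * x) / K)) (x : ℂ) := by
      have e1 : ∀ a : ℂ, HasDerivAt (fun x : ℂ => Complex.exp (a * x))
          (Complex.exp (a * x) * a) (x : ℂ) := by
        intro a
        simpa using ((hasDerivAt_id (x : ℂ)).const_mul a).cexp
      have e2 : HasDerivAt (fun x : ℂ => -(x - 1/2 + 1/c)) (-1) (x : ℂ) :=
        (((hasDerivAt_id (x : ℂ)).sub_const (1/2)).add_const (1/c)).neg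
      refine ((((e2.mul (e1 (-d))).div_const d).sub ((e1 (-d)).div_const (d^2))).sub
        ((e1 (c-d)).div_const ((c-d)*K))).congr_deriv ?_
      have : Complex.exp ((c - d) * x) = Complex.exp (-d*x) * Complex.exp (c * x) := by
        rw [← Complex.exp_add]; ring_nf
      rw [this]
      generalize Complex.exp (-d*x) = u
      generalize Complex.exp (c*x) = v
      generalize 1 / c = w
      field_simp
      ring
    exact h0.comp_ofReal
  rw [intervalIntegral.integral_eq_sub_of_hasDerivAt (fun x _ => key x)
    (Continuous.intervalIntegrable (by fun_prop) _ _)]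
  have h1 : Complex.exp (-d) = 1 := by rw [Complex.exp_neg, hexp, inv_one]
  have h2 : Complex.exp (c - d) = K + 1 := by rw [Complex.exp_sub, hexp, hcK, div_one]
  simp only [ofReal_one, ofReal_zero, mul_one, mul_zero, Complex.exp_zero, h1, h2]
  generalize 1 / c = w
  field_simp
  ring

lemma aux_int_zero (c K : ℂ) (hK : K ≠ 0) (hcK : Complex.exp c = K + 1) (hc : c ≠ 0) :
    ∫ x in (0:ℝ)..1, ((x : ℂ) - 1/2 + 1/c - Complex.exp (c * x) / K) = 0 := by
  have key : ∀ x : ℝ, HasDerivAt (fun x : ℝ => (x : ℂ)^2/2 + (-1/2 + 1/c) * x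
      - Complex.exp (c * x) / (c * K))
      ((x : ℂ) - 1/2 + 1/c - Complex.exp (c * x) / K) x := by
    intro x
    have h0 : HasDerivAt (fun x : ℂ => x^2/2 + (-1/2 + 1/c) * x
      - Complex.exp (c * x) / (c * K))
      ((x : ℂ) - 1/2 + 1/c - Complex.exp (c * x) / K) (x : ℂ) := by
      have e1 : HasDerivAt (fun x : ℂ => Complex.exp (c * x))
          (Complex.exp (c * x) * c) (x : ℂ) := by
        simpa using ((hasDerivAt_id (x : ℂ)).const_mul c).cexp
      refine ((((hasDerivAt_pow 2 (x : ℂ)).div_const 2).add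
        ((hasDerivAt_id (x : ℂ)).const_mul (-1/2 + 1/c))).sub
          (e1.div_const (c * K))).congr_deriv ?_
      field_simp
      push_cast
      ring
    exact h0.comp_ofReal
  rw [intervalIntegral.integral_eq_sub_of_hasDerivAt (fun x _ => key x)
    (Continuous.intervalIntegrable (by fun_prop) _ _)]
  simp only [ofReal_one, ofReal_zero, mul_one, mul_zero, Complex.exp_zero, hcK]
  field_simp
  ring

lemma aux_ne (y : ℝ) (hy : 0 < y) (m : ℤ) : (m : ℂ) + 2 * Complex.I * y ≠ 0 := by
  intro h
  have := congrArg Complex.im h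
  simp at this
  exact hy.ne' this

lemma aux_summable (y : ℝ) (hy : 0 < y) :
    Summable (fun m : ℤ => if m = 0 then (0:ℂ) else
      (1 / ((m : ℂ) + 2 * Complex.I * (y : ℂ)) - 1 / (m : ℂ))) := by
  refine Summable.of_norm_bounded (g := fun m : ℤ => 2 * y * (1 / (m:ℝ)^2))
    ((Real.summable_one_div_int_pow.2 one_lt_two).mul_left _) ?_
  intro m
  split_ifs with hm
  · simp [hm]
  have hm' : (m : ℂ) ≠ 0 := by exact_mod_cast hm
  have hz := aux_ne y hy m
  have e : (1 / ((m : ℂ) + 2 * Complex.I * (y : ℂ)) - 1 / (m : ℂ))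
      = - (2 * Complex.I * y) / (((m : ℂ) + 2 * Complex.I * (y : ℂ)) * m) := by
    field_simp
    ring
  have hle : |(m:ℝ)| ≤ ‖(m : ℂ) + 2 * Complex.I * (y : ℂ)‖ := by
    have := Complex.abs_re_le_norm ((m : ℂ) + 2 * Complex.I * (y : ℂ))
    simpa using this
  have hm0 : 0 < |(m:ℝ)| := by positivity
  rw [e, norm_div, norm_neg, norm_mul, norm_mul, norm_mul, Complex.norm_I, Complex.norm_intCast,
    Complex.norm_real, Real.norm_of_nonneg hy.le, ← sq_abs (m:ℝ), mul_one_div]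
  simp only [Complex.norm_ofNat, mul_one]
  rw [sq]
  gcongr

lemma aux_hasSum (y : ℝ) (hy : 0 < y) (t : ℝ) (ht : t ∈ Set.Ico (0:ℝ) 1) :
    HasSum (fun m : ℤ => (if m = 0 then (0:ℂ) else
      (1 / ((m : ℂ) + 2 * Complex.I * (y : ℂ)) - 1 / (m : ℂ))) *
        Complex.exp (2 * (π : ℂ) * Complex.I * (m : ℂ) * (t : ℂ)))
      (2 * π * Complex.I * ((t : ℂ) - 1/2 + 1/(4 * π * y : ℝ) -
        Complex.exp ((4 * π * y : ℝ) * t) / (Complex.exp ((4 * π * y : ℝ)) - 1))) := by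
  set c : ℂ := ((4 * π * y : ℝ) : ℂ) with hc
  have hcpos : 0 < 4 * π * y := by positivity
  have hc0 : c ≠ 0 := by rw [hc]; exact_mod_cast hcpos.ne'
  set K : ℂ := Complex.exp c - 1 with hKdef
  have hcK : Complex.exp c = K + 1 := by rw [hKdef]; ring
  have hK : K ≠ 0 := by
    rw [hKdef, hc, ← Complex.ofReal_exp]
    have : 1 < Real.exp (4 * π * y) := Real.one_lt_exp_iff.2 hcpos
    have h2 : Real.exp (4 * π * y) - 1 ≠ 0 := by linarith
    exact_mod_cast h2
  let h : ℝ → ℂ := fun x => 2 * π * Complex.I * ((x : ℂ) - 1/2 + 1/c - Complex.exp (c * x) / K)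
  have hcont : Continuous h := by fun_prop
  have hper : h 0 = h 1 := by
    simp only [h, ofReal_one, ofReal_zero, mul_one, mul_zero, Complex.exp_zero, hcK]
    generalize 1 / c = w
    field_simp
    ring
  have : Fact ((0:ℝ) < 1) := ⟨one_pos⟩
  let B : C(AddCircle (1:ℝ), ℂ) := ⟨AddCircle.liftIco 1 0 h,
    AddCircle.liftIco_zero_continuous hper hcont.continuousOn⟩
  have step1 : ∀ m : ℤ, fourierCoeff B m = if m = 0 then (0:ℂ) else
      (1 / ((m : ℂ) + 2 * Complex.I * (y : ℂ)) - 1 / (m : ℂ)) := by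
    intro m
    have e0 : fourierCoeff B m = ∫ x in (0:ℝ)..1, 2 * π * Complex.I *
        (Complex.exp (-(2 * π * Complex.I * m) * x) *
          ((x : ℂ) - 1/2 + 1/c - Complex.exp (c * x) / K)) := by
      change fourierCoeff (AddCircle.liftIco 1 0 h) m = _
      rw [fourierCoeff_eq_intervalIntegral _ _ 0]
      simp only [zero_add, div_one, one_smul]
      refine intervalIntegral.integral_congr_Ioo_of_le zero_le_one fun x hx => ?_
      have hx' : x ∈ Set.Ico (0:ℝ) (0 + 1) := by
        rw [zero_add]; exact Set.Ioo_subset_Ico_self hx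
      rw [AddCircle.liftIco_coe_apply hx', fourier_coe_apply]
      simp only [h, smul_eq_mul]
      have : 2 * (π:ℂ) * Complex.I * ((-m : ℤ) : ℂ) * x / ((1:ℝ):ℂ)
        = -(2 * π * Complex.I * m) * x := by push_cast; ring
      rw [this]
      ring
    rw [e0, intervalIntegral.integral_const_mul]
    split_ifs with hm
    · subst hm
      simp only [Int.cast_zero, mul_zero, neg_zero, zero_mul, Complex.exp_zero, one_mul]
      rw [aux_int_zero c K hK hcK hc0, mul_zero]
    · have hm' : (m : ℂ) ≠ 0 := by exact_mod_cast hm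
      have hz := aux_ne y hy m
      have hpi : (2 * π * Complex.I : ℂ) ≠ 0 := Complex.two_pi_I_ne_zero
      have hcd : c - 2 * π * Complex.I * m = -(2 * π * Complex.I) * (m + 2 * Complex.I * y) := by
        rw [hc]; push_cast
        linear_combination (4 * π * y : ℂ) * Complex.I_mul_I
      have hex : Complex.exp (2 * π * Complex.I * m) = 1 := by
        rw [mul_comm]; exact Complex.exp_int_mul_two_pi_mul_I m
      rw [aux_int_ne c K _ hK hcK (mul_ne_zero hpi hm')
        (by rw [hcd]; exact mul_ne_zero (neg_ne_zero.2 hpi) hz) hex, hcd]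
      generalize (2 * π * Complex.I : ℂ) = p at *
      generalize (m + 2 * Complex.I * y : ℂ) = q at *
      field_simp
      ring
  have step2 := has_pointwise_sum_fourier_series_of_summable
      ((aux_summable y hy).congr fun n => (step1 n).symm) (t : AddCircle (1:ℝ))
  simp_rw [step1] at step2
  convert step2 using 1
  · ext m
    rw [fourier_coe_apply]
    simp
  · change _ = AddCircle.liftIco 1 0 h t
    rw [AddCircle.liftIco_coe_apply (show t ∈ Set.Ico (0:ℝ) (0 + 1) by rwa [zero_add])]

lemma aux_limit (t : ℝ) (ht : t < 1) :
    Tendsto (fun y : ℝ => (2 * π * Complex.I * ((t : ℂ) - 1/2 + 1/(4 * π * y : ℝ) -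
        Complex.exp ((4 * π * y : ℝ) * t) / (Complex.exp ((4 * π * y : ℝ)) - 1)))) atTop
      (nhds (2 * π * Complex.I * ((t : ℂ) - 1/2))) := by
  have hc : Tendsto (fun y : ℝ => 4 * π * y) atTop atTop :=
    tendsto_id.const_mul_atTop (by positivity)
  have hr : Tendsto (fun c : ℝ => t - 1/2 + 1/c - Real.exp (c * t) / (Real.exp c - 1)) atTop
      (nhds (t - 1/2)) := by
    have a1 : Tendsto (fun c : ℝ => 1/c) atTop (nhds 0) := by
      simpa using tendsto_inv_atTop_zero (𝕜 := ℝ)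
    have a2 : Tendsto (fun c : ℝ => Real.exp (-(c * (1-t)))) atTop (nhds 0) :=
      Real.tendsto_exp_neg_atTop_nhds_zero.comp (tendsto_id.atTop_mul_const (by linarith))
    have a3 : Tendsto (fun c : ℝ => 1 - Real.exp (-c)) atTop (nhds (1 - 0)) :=
      Real.tendsto_exp_neg_atTop_nhds_zero.const_sub 1
    have a4 := a2.div a3 (by norm_num)
    have a5 := (a1.const_add (t - 1/2)).sub a4
    simp only [sub_zero, zero_div, add_zero] at a5
    refine a5.congr fun c => ?_
    congr 1
    simp only [Pi.div_apply]
    have : Real.exp (c * t) = Real.exp c * Real.exp (-(c * (1-t))) := by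
      rw [← Real.exp_add]; ring_nf
    have h2 : Real.exp c - 1 = Real.exp c * (1 - Real.exp (-c)) := by
      rw [mul_sub, ← Real.exp_add]; simp
    rw [this, h2, mul_div_mul_left _ _ (Real.exp_pos c).ne']
  have := ((Complex.continuous_ofReal.tendsto _).comp (hr.comp hc)).const_mul
    (2 * π * Complex.I)
  simp only [Function.comp_def] at this
  push_cast at this ⊢
  exact this

/-- For `-1 < α < 1` and every `y > 0`, the series
`∑_{m ∈ ℤ, m ≠ 0} (1/(m + 2iy) − 1/m)·e^{2πimα}` converges absolutely, and its sum
tends, as `y → +∞`, to `−2πi·sgn(α)·(1/2 − |α|)` (with the convention `sgn 0 = 1`). -/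
theorem tendsto_sum_resolvent_series (α : ℝ) (h₁ : -1 < α) (h₂ : α < 1) :
    (∀ y : ℝ, 0 < y →
      Summable (fun m : {m : ℤ // m ≠ 0} =>
        ‖(1 / ((m.1 : ℂ) + 2 * Complex.I * (y : ℂ)) - 1 / (m.1 : ℂ)) *
          Complex.exp (2 * (π : ℂ) * Complex.I * (m.1 : ℂ) * (α : ℂ))‖)) ∧
    Tendsto (fun y : ℝ =>
        ∑' m : {m : ℤ // m ≠ 0},
          (1 / ((m.1 : ℂ) + 2 * Complex.I * (y : ℂ)) - 1 / (m.1 : ℂ)) *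
            Complex.exp (2 * (π : ℂ) * Complex.I * (m.1 : ℂ) * (α : ℂ)))
      atTop
      (nhds (-2 * (π : ℂ) * Complex.I * ((sgn' α : ℝ) : ℂ) * ((1 : ℂ) / 2 - (|α| : ℝ)))) := by
  have hsumm : ∀ y : ℝ, 0 < y →
      Summable (fun m : {m : ℤ // m ≠ 0} =>
        ‖(1 / ((m.1 : ℂ) + 2 * Complex.I * (y : ℂ)) - 1 / (m.1 : ℂ)) *
          Complex.exp (2 * (π : ℂ) * Complex.I * (m.1 : ℂ) * (α : ℂ))‖) := by
    intro y hy
    refine ((aux_summable y hy).norm.subtype {m : ℤ | m ≠ 0}).congr fun m => ?_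
    have hm : m.1 ≠ 0 := m.2
    have e : 2 * (π : ℂ) * Complex.I * (m.1 : ℂ) * (α : ℂ)
        = ((2 * π * m.1 * α : ℝ) : ℂ) * Complex.I := by push_cast; ring
    simp only [Function.comp_apply, if_neg hm]
    rw [norm_mul, e, Complex.norm_exp_ofReal_mul_I, mul_one]
  refine ⟨hsumm, ?_⟩
  have ht : Int.fract α ∈ Set.Ico (0:ℝ) 1 := ⟨Int.fract_nonneg _, Int.fract_lt_one _⟩
  have hval : (-2 * (π : ℂ) * Complex.I * ((sgn' α : ℝ) : ℂ) * ((1 : ℂ) / 2 - (|α| : ℝ)))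
      = 2 * π * Complex.I * ((Int.fract α : ℝ) - 1/2) := by
    rcases lt_or_ge α 0 with h | h
    · have hf : Int.fract α = α + 1 := by
        rw [Int.fract_eq_iff]
        exact ⟨by linarith, by linarith, -1, by push_cast; ring⟩
      rw [hf, abs_of_neg h, sgn', if_neg h.ne, Real.sign_of_neg h]
      push_cast; ring
    · have hf : Int.fract α = α := Int.fract_eq_self.2 ⟨h, h₂⟩
      have hs : sgn' α = 1 := by
        rw [sgn']
        split_ifs with h0
        · rfl
        · exact Real.sign_of_pos (lt_of_le_of_ne h (Ne.symm h0))
      rw [hf, abs_of_nonneg h, hs]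
      push_cast; ring
  rw [hval]
  refine (aux_limit _ ht.2).congr' ?_
  filter_upwards [eventually_gt_atTop 0] with y hy
  have H := aux_hasSum y hy _ ht
  rw [← hasSum_subtype_iff_of_support_subset (s := {m : ℤ | m ≠ 0})] at H
  · rw [← H.tsum_eq]
    refine tsum_congr fun m => ?_
    have hm : m.1 ≠ 0 := m.2
    simp only [Function.comp_apply, if_neg hm]
    congr 1
    have e : 2 * (π : ℂ) * Complex.I * (m.1 : ℂ) * (α : ℂ)
        = 2 * (π : ℂ) * Complex.I * (m.1 : ℂ) * ((Int.fract α : ℝ) : ℂ)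
          + ((m.1 * ⌊α⌋ : ℤ) : ℂ) * (2 * π * Complex.I) := by
      rw [Int.fract]; push_cast; ring
    rw [e, Complex.exp_add, Complex.exp_int_mul_two_pi_mul_I, mul_one]
  · intro m hm h0
    simp [h0] at hm
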